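/- There do not exist four distinct points v₁, v₂, v₃, v₄ on the unit circle in ℂ together with six injective paths p_{ij} in the circle from vᵢ to vⱼ (for 1 ≤ i < j ≤ 4) such that the interiors of the six paths are pairwise disjoint and each interior is disjoint from {v₁, v₂, v₃, v₄}. Equivalently, the complete graph K₄ (and hence the complete multipartite graph K_{1,1,1,1}) does not embed in a circle. -/

import Mathlib

open unitInterval

/-- The interior of a path: the image of the open unit interval. -/
def pathInterior {X : Type*} [TopologicalSpace X] {x y : X} (p : Path x y) : Set X :=
  ⇑p '' {t : I | t ≠ 0 ∧ t ≠ 1}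

/-- The angle of a point of the circle, measured from the antipode of `x`. -/
noncomputable def antipodalArg (x w : Circle) : ℝ := Complex.arg (-((w / x : Circle) : ℂ))

lemma antipodalArg_injective (x : Circle) : Function.Injective (antipodalArg x) := by
  intro a b h
  have h' : -((a / x : Circle) : ℂ) = -((b / x : Circle) : ℂ) :=
    Complex.ext_norm_arg (by rw [norm_neg, norm_neg, Circle.norm_coe, Circle.norm_coe]) h
  exact div_left_injective (Circle.ext (neg_injective h'))

lemma cos_antipodalArg (x w : Circle) :
    Real.cos (antipodalArg x w) = -((w / x : Circle) : ℂ).re := by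
  rw [antipodalArg, Complex.cos_arg (neg_ne_zero.mpr (Circle.coe_ne_zero _))]
  rw [norm_neg, Circle.norm_coe, div_one, Complex.neg_re]

lemma neg_div_mem_slitPlane {x w : Circle} (h : w ≠ x) :
    -((w / x : Circle) : ℂ) ∈ Complex.slitPlane := by
  rw [Complex.mem_slitPlane_iff_arg]
  refine ⟨fun hπ => h ?_, neg_ne_zero.mpr (Circle.coe_ne_zero _)⟩
  apply antipodalArg_injective x
  rw [antipodalArg, hπ, antipodalArg]
  simp

lemma abs_antipodalArg_lt_pi {x w : Circle} (h : w ≠ x) : |antipodalArg x w| < Real.pi :=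
  lt_of_le_of_ne (Complex.abs_arg_le_pi _) fun hπ => by
    have hx : antipodalArg x x = Real.pi := by simp [antipodalArg]
    rcases eq_or_eq_neg_of_abs_eq hπ with h1 | h1
    · exact h (antipodalArg_injective x (h1.trans hx.symm))
    · exact (Complex.neg_pi_lt_arg _).ne' h1

lemma continuousOn_antipodalArg (x : Circle) : ContinuousOn (antipodalArg x) {x}ᶜ := by
  intro w hw
  have hc : Continuous fun w : Circle => -((w / x : Circle) : ℂ) := by fun_prop
  exact ((Complex.continuousAt_arg (neg_div_mem_slitPlane hw)).comp
    (f := fun w : Circle => -((w / x : Circle) : ℂ)) hc.continuousAt).continuousWithinAt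

lemma isPreconnected_pathInterior {X : Type*} [TopologicalSpace X] {x y : X} (p : Path x y) :
    IsPreconnected (pathInterior p) := by
  have h : {t : I | t ≠ 0 ∧ t ≠ 1} = Set.Ioo 0 1 := by
    ext t
    simp [unitInterval.pos_iff_ne_zero, unitInterval.lt_one_iff_ne_one]
  rw [pathInterior, h]
  exact isPreconnected_Ioo.image _ p.continuous.continuousOn

lemma source_mem_closure_pathInterior {X : Type*} [TopologicalSpace X] {x y : X} (p : Path x y) :
    x ∈ closure (pathInterior p) := by
  have h : Set.Ioo (0 : I) 1 ⊆ {t : I | t ≠ 0 ∧ t ≠ 1} := fun t ht => ⟨ht.1.ne', ht.2.ne⟩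
  have h0 : (0 : I) ∈ closure {t : I | t ≠ 0 ∧ t ≠ 1} := by
    apply closure_mono h
    rw [closure_Ioo zero_ne_one]
    simp
  simpa [pathInterior] using image_closure_subset_closure_image p.continuous (Set.mem_image_of_mem p h0)

/-- A connected subset of the circle accumulating at `x`, but avoiding `x`, does not lie between
two points outside it. -/
lemma not_antipodalArg_between {x a b c : Circle} {S : Set Circle} (hS : IsPreconnected S)
    (hxS : x ∉ S) (hx : x ∈ closure S) (ha : a ∉ S) (hc : c ∉ S) (hb : b ∈ S) (hax : a ≠ x)
    (hcx : c ≠ x) (hab : antipodalArg x a < antipodalArg x b)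
    (hbc : antipodalArg x b < antipodalArg x c) : False := by
  have hord : (antipodalArg x '' S).OrdConnected :=
    (hS.image _ ((continuousOn_antipodalArg x).mono
      (Set.subset_compl_singleton_iff.mpr hxS))).ordConnected
  have hnot : ∀ {d}, d ∉ S → antipodalArg x d ∉ antipodalArg x '' S := fun hd =>
    (antipodalArg_injective x).mem_set_image.not.mpr hd
  set M := max |antipodalArg x a| |antipodalArg x c|
  have hM : M < Real.pi := max_lt (abs_antipodalArg_lt_pi hax) (abs_antipodalArg_lt_pi hcx)
  have hbound : ∀ w ∈ S, Real.cos M ≤ -((w / x : Circle) : ℂ).re := by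
    intro w hw
    rw [← cos_antipodalArg, ← Real.cos_abs (antipodalArg x w)]
    refine Real.cos_le_cos_of_nonneg_of_le_pi (abs_nonneg _) hM.le ?_
    refine abs_le_max_abs_abs ?_ ?_
    · by_contra! h
      exact hnot ha (hord.out ⟨w, hw, rfl⟩ ⟨b, hb, rfl⟩ ⟨h.le, hab.le⟩)
    · by_contra! h
      exact hnot hc (hord.out ⟨b, hb, rfl⟩ ⟨w, hw, rfl⟩ ⟨hbc.le, h.le⟩)
  have hclosed : IsClosed {w : Circle | Real.cos M ≤ -((w / x : Circle) : ℂ).re} :=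
    isClosed_le continuous_const (by fun_prop)
  have hx' : Real.cos M ≤ -((x / x : Circle) : ℂ).re :=
    closure_minimal hbound hclosed hx
  have hlt := Real.cos_lt_cos_of_nonneg_of_le_pi (le_max_of_le_left (abs_nonneg _)) le_rfl hM
  rw [Real.cos_pi] at hlt
  simp only [div_self', Circle.coe_one, Complex.one_re] at hx'
  exact hlt.not_ge hx'

/-- The complete graph `K₄` (equivalently, `K_{1,1,1,1}`) does not embed in the circle: there do
not exist four distinct points on the unit circle together with six injective paths in the
circle joining them pairwise, whose interiors are pairwise disjoint and disjoint from the four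
points. -/
theorem K4_not_embeddable_in_circle :
    ¬ ∃ (v : Fin 4 → Circle) (_ : Function.Injective v)
        (p : ∀ i j : Fin 4, i < j → Path (v i) (v j)),
      (∀ (i j : Fin 4) (hij : i < j), Function.Injective ⇑(p i j hij)) ∧
      (∀ (i j : Fin 4) (hij : i < j) (k l : Fin 4) (hkl : k < l), (i, j) ≠ (k, l) →
        Disjoint (pathInterior (p i j hij)) (pathInterior (p k l hkl))) ∧
      (∀ (i j : Fin 4) (hij : i < j), Disjoint (pathInterior (p i j hij)) (Set.range v)) := by
  rintro ⟨v, -, p, -, hdisj, hvert⟩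
  have hex : ∀ j : Fin 4, ∀ hj : 0 < j, ∃ w, w ∈ pathInterior (p 0 j hj) := fun j hj =>
    closure_nonempty_iff.mp ⟨_, source_mem_closure_pathInterior _⟩
  have havoid : ∀ j hj, v 0 ∉ pathInterior (p 0 j hj) := fun j hj h =>
    Set.disjoint_left.mp (hvert 0 j hj) h ⟨0, rfl⟩
  choose w hw using hex
  have hne : ∀ j hj, w j hj ≠ v 0 := fun j hj h => havoid j hj (by simpa only [h] using hw j hj)
  have hout : ∀ {j k} (hj : 0 < j) (hk : 0 < k), j ≠ k → w j hj ∉ pathInterior (p 0 k hk) :=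
    fun {j k} hj hk hjk => Set.disjoint_left.mp
      (hdisj 0 j hj 0 k hk (fun h => hjk (Prod.ext_iff.mp h).2)) (hw j hj)
  have hbetween : ∀ {i j k} (hi : 0 < i) (hj : 0 < j) (hk : 0 < k), i ≠ j → k ≠ j →
      antipodalArg (v 0) (w i hi) < antipodalArg (v 0) (w j hj) →
      antipodalArg (v 0) (w j hj) < antipodalArg (v 0) (w k hk) → False :=
    fun hi hj hk hij hkj => not_antipodalArg_between (isPreconnected_pathInterior _)
      (havoid _ hj) (source_mem_closure_pathInterior _) (hout hi hj hij) (hout hk hj hkj)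
      (hw _ hj) (hne _ hi) (hne _ hk)
  have hangle : ∀ {j k} (hj : 0 < j) (hk : 0 < k), j ≠ k →
      antipodalArg (v 0) (w j hj) ≠ antipodalArg (v 0) (w k hk) := fun hj hk hjk h =>
    hout hj hk hjk (by simpa only [antipodalArg_injective _ h] using hw _ hk)
  have h1 : (0 : Fin 4) < 1 := by decide
  have h2 : (0 : Fin 4) < 2 := by decide
  have h3 : (0 : Fin 4) < 3 := by decide
  rcases lt_or_gt_of_ne (hangle h1 h2 (by decide)) with h12 | h12 <;>
  rcases lt_or_gt_of_ne (hangle h2 h3 (by decide)) with h23 | h23 <;>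
  rcases lt_or_gt_of_ne (hangle h1 h3 (by decide)) with h13 | h13 <;>
  first
    | exact hbetween _ _ _ (by decide) (by decide) h12 h23
    | exact hbetween _ _ _ (by decide) (by decide) h23 h12
    | exact hbetween _ _ _ (by decide) (by decide) h12 h13
    | exact hbetween _ _ _ (by decide) (by decide) h13 h12
    | exact hbetween _ _ _ (by decide) (by decide) h13 h23
    | exact hbetween _ _ _ (by decide) (by decide) h23 h13
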